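/- Let a ≥ 1. Define γ : J(L_a) → S_a by γ(I) = (γ_1(I), …, γ_a(I)) where γ_j(I) = |C_{a+1−j}(I)| for 1 ≤ j ≤ a. Then γ is a well-defined bijection from J(L_a) onto S_a, and for every I ∈ J(L_a) and every 1 ≤ j ≤ a, γ(σ_{C_j}(I)) = WZ_{a+1−j}(γ(I)). -/

import Mathlib

/-- An order ideal (down-closed subset) of a poset, as a `Finset`. -/
def IsIdeal {α : Type*} [PartialOrder α] (I : Finset α) : Prop :=
  ∀ x ∈ I, ∀ y, y ≤ x → y ∈ I

-- The toggle `σ_x`: add `x` if the result is still an order ideal, remove `x` if the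
-- result is still an order ideal, otherwise do nothing.
open Classical in
noncomputable def toggle {α : Type*} [PartialOrder α] (x : α) (I : Finset α) : Finset α :=
  if x ∉ I ∧ IsIdeal (insert x I) then insert x I
  else if x ∈ I ∧ IsIdeal (I.erase x) then I.erase x
  else I

-- The poset `L_a` (the staircase): the subposet of `[a] × [a]` of pairs `(i, j)` with
-- `i ≤ j`, with the inherited (componentwise) order.  Its 0-based column `i` consists
-- of the pairs `(i, j)` with `i ≤ j`.
abbrev La (a : ℕ) := {p : Fin a × Fin a // p.1.val ≤ p.2.val}

-- `colCardL I i = |C_{i+1}(I)|`: the number of elements of `I` in (0-based) column `i`.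
def colCardL {a : ℕ} (I : Finset (La a)) (i : Fin a) : ℕ :=
  (I.filter (fun p => p.1.1 = i)).card

-- The column toggle `σ_{C_i}` on `J(L_a)`, toggling the elements of column `i` from the
-- topmost down to the bottommost.
noncomputable def colToggleL {a : ℕ} (i : Fin a) (I : Finset (La a)) : Finset (La a) :=
  List.foldr
    (fun (j : Fin a) K =>
      if h : i.val ≤ j.val then toggle (⟨(i, j), h⟩ : La a) K else K)
    I (List.ofFn (fun j : Fin a => j))

-- Comotion `T_ν = σ_{C_{ν(a)}} ∘ … ∘ σ_{C_{ν(1)}}` on `J(L_a)`.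
noncomputable def comotionL {a : ℕ} (ν : Equiv.Perm (Fin a)) (I : Finset (La a)) :
    Finset (La a) :=
  List.foldl (fun K t => colToggleL (ν t) K) I (List.ofFn (fun t : Fin a => t))

-- The set `S_n`: tuples `(x_1, …, x_n)` which consist of a (possibly empty) prefix of
-- zeros followed by a strictly increasing sequence of values in `{1, …, n}`.
def SZmem (n : ℕ) (x : Fin n → ℕ) : Prop :=
  (∀ i, x i ≤ n) ∧ ∀ i j : Fin n, i < j → (x i = 0 ∨ x i < x j)

-- `extZ n x j` is the `j`-th entry of `x` in 0-based indexing, with the convention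
-- that entries past the end equal `n + 1`.
def extZ (n : ℕ) (x : Fin n → ℕ) (j : ℕ) : ℕ :=
  if h : j < n then x ⟨j, h⟩ else n + 1

-- Winching with zeros at (0-based) index `i`:
-- `y_i = x_i + 1` if `x_i + 1 < min(x_{i+1}, n+1)`; otherwise `y_i = x_{i−1} + 1`
-- if `i > 1` and `x_{i−1} > 0`; otherwise `y_i = 0`.
def winchZ (n : ℕ) (i : Fin n) (x : Fin n → ℕ) : Fin n → ℕ := fun j =>
  if j = i then
    (if x i + 1 < min (extZ n x (i.val + 1)) (n + 1) then x i + 1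
     else if 0 < i.val ∧ 0 < x ⟨i.val - 1, lt_of_le_of_lt (Nat.sub_le _ _) i.isLt⟩ then
       x ⟨i.val - 1, lt_of_le_of_lt (Nat.sub_le _ _) i.isLt⟩ + 1
     else 0)
  else x j

-- `WZ_ν = WZ_{ν(n)} ∘ … ∘ WZ_{ν(1)}` (so `WZ_{ν(1)}` is applied first).
def winchZPerm (n : ℕ) (ν : Equiv.Perm (Fin n)) (x : Fin n → ℕ) : Fin n → ℕ :=
  List.foldl (fun y t => winchZ n (ν t) y) x (List.ofFn (fun t : Fin n => t))

-- The bijection `γ : J(L_a) → S_a`, `γ_j(I) = |C_{a+1−j}(I)|` (1-based `j`);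
-- in 0-based indexing, `γ(I) j = |C_{j.rev}(I)|`.
def gammaMap (a : ℕ) (I : Finset (La a)) : Fin a → ℕ := fun j =>
  colCardL I j.rev

section Toggle

variable {α : Type*} [PartialOrder α]

theorem IsIdeal.toggle {x : α} {I : Finset α} (hI : IsIdeal I) : IsIdeal (toggle x I) := by
  unfold _root_.toggle
  split_ifs with h₁ h₂
  exacts [h₁.2, h₂.2, hI]

theorem mem_toggle_of_ne {x y : α} {I : Finset α} (hxy : y ≠ x) : y ∈ toggle x I ↔ y ∈ I := by
  unfold toggle
  split_ifs <;> simp [hxy]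

theorem mem_toggle_self {x : α} {I : Finset α} (hI : IsIdeal I) :
    x ∈ toggle x I ↔ (∃ z, x < z ∧ z ∈ I) ∨ (x ∉ I ∧ ∀ z < x, z ∈ I) := by
  classical
  have hinsert : IsIdeal (insert x I) ↔ ∀ z < x, z ∈ I := by
    constructor
    · intro h z hz
      simpa [hz.ne] using h x (by simp) z hz.le
    · intro h y hy z hz
      rcases Finset.mem_insert.1 hy with rfl | hy
      · rcases hz.eq_or_lt with rfl | hz
        · simp
        · simp [h z hz]
      · simp [hI y hy z hz]
  have herase : IsIdeal (I.erase x) ↔ ∀ z, x < z → z ∉ I := by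
    constructor
    · intro h z hz hzI
      simpa using h z (by simp [hz.ne', hzI]) x hz.le
    · intro h y hy z hz
      rw [Finset.mem_erase] at hy ⊢
      refine ⟨?_, hI y hy.2 z hz⟩
      rintro rfl
      exact h y (lt_of_le_of_ne hz hy.1.symm) hy.2
  by_cases hx : x ∈ I
  · by_cases he : IsIdeal (I.erase x)
    · simpa [toggle, hx, he] using herase.1 he
    · have hz : ∃ z, x < z ∧ z ∈ I := by simpa using mt herase.2 he
      simp [toggle, hx, he, hz]
  · have hz : ¬ ∃ z, x < z ∧ z ∈ I := fun ⟨z, hz, hzI⟩ ↦ hx (hI z hzI x hz.le)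
    by_cases hi : IsIdeal (insert x I)
    · simpa [toggle, hx, hi] using Or.inr (hinsert.1 hi)
    · simp only [toggle, hx, hi, hz, ← hinsert]
      simp [hx]

end Toggle

theorem colCardL_eq_of_mem_iff {a : ℕ} {I : Finset (La a)} {i : Fin a} {c : ℕ}
    (hc : i.val + c ≤ a)
    (hI : ∀ p : La a, p.1.1 = i → (p ∈ I ↔ p.1.2.val < i.val + c)) : colCardL I i = c := by
  have hmaps : I.filter (fun p ↦ p.1.1 = i) = Finset.univ.image
      (fun k : Fin c ↦ (⟨(i, ⟨i.val + k, by omega⟩), by simp⟩ : La a)) := by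
    ext ⟨⟨i', j⟩, hij⟩
    simp only [Finset.mem_filter, Finset.mem_image, Finset.mem_univ, true_and, Subtype.mk.injEq,
      Prod.mk.injEq]
    constructor
    · rintro ⟨hmem, rfl⟩
      have hlt := (hI _ rfl).1 hmem
      simp only at hlt hij
      exact ⟨⟨j - i', by omega⟩, rfl, Fin.ext (by simp; omega)⟩
    · rintro ⟨k, rfl, rfl⟩
      exact ⟨(hI _ rfl).2 (by simp), rfl⟩
  rw [colCardL, hmaps, Finset.card_image_of_injective _ (fun k l h ↦ ?_), Finset.card_fin]
  simpa [Fin.ext_iff] using h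

theorem IsIdeal.exists_col_bound {a : ℕ} {I : Finset (La a)} (hI : IsIdeal I) (i : Fin a) :
    ∃ c, i.val + c ≤ a ∧ ∀ p : La a, p.1.1 = i → (p ∈ I ↔ p.1.2.val < i.val + c) := by
  classical
  have hex : ∃ c, ∀ h : i.val + c < a, (⟨(i, ⟨i.val + c, h⟩), by simp⟩ : La a) ∉ I :=
    ⟨a, fun h ↦ by omega⟩
  refine ⟨Nat.find hex, ?_, ?_⟩
  · have := Nat.find_min' hex (m := a - i.val) (fun h ↦ by omega)
    omega
  · rintro ⟨⟨i', j⟩, hij⟩ rfl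
    simp only at hij hex ⊢
    constructor
    · intro hmem
      by_contra! hle
      exact Nat.find_spec hex (by omega) (hI _ hmem _ ⟨le_rfl, hle⟩)
    · intro hlt
      have hmin := Nat.find_min hex (m := j.val - i'.val) (by omega)
      push Not at hmin
      obtain ⟨h, hmem⟩ := hmin
      convert hmem
      omega

theorem IsIdeal.add_colCardL_le {a : ℕ} {I : Finset (La a)} (hI : IsIdeal I) (i : Fin a) :
    i.val + colCardL I i ≤ a := by
  obtain ⟨c, hc, hmem⟩ := hI.exists_col_bound i
  rwa [colCardL_eq_of_mem_iff hc hmem]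

theorem IsIdeal.mem_iff_lt {a : ℕ} {I : Finset (La a)} (hI : IsIdeal I) (i j : Fin a)
    (hij : i.val ≤ j.val) :
    (⟨(i, j), hij⟩ : La a) ∈ I ↔ j.val < i.val + colCardL I i := by
  obtain ⟨c, hc, hmem⟩ := hI.exists_col_bound i
  rw [colCardL_eq_of_mem_iff hc hmem]
  exact hmem _ rfl

theorem IsIdeal.colCardL_lt {a : ℕ} {I : Finset (La a)} (hI : IsIdeal I) {i j : Fin a}
    (hij : i < j) : colCardL I j = 0 ∨ colCardL I j < colCardL I i := by
  rcases Nat.eq_zero_or_pos (colCardL I j) with h | h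
  · exact Or.inl h
  · right
    have hj := hI.add_colCardL_le j
    let k : Fin a := ⟨j.val + colCardL I j - 1, by omega⟩
    have hjk : j.val ≤ k.val := by simp only [k]; omega
    have hij' : i.val < j.val := hij
    have hik : i.val ≤ k.val := by omega
    have hmem : (⟨(i, k), hik⟩ : La a) ∈ I :=
      hI _ ((hI.mem_iff_lt j k hjk).2 (by simp only [k]; omega)) _ ⟨hij.le, le_rfl⟩
    have := (hI.mem_iff_lt i k hik).1 hmem
    simp only [k] at this
    omega

theorem IsIdeal.szmem_gammaMap {a : ℕ} {I : Finset (La a)} (hI : IsIdeal I) :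
    SZmem a (gammaMap a I) := by
  refine ⟨fun i ↦ ?_, fun i j hij ↦ hI.colCardL_lt (Fin.rev_lt_rev.2 hij)⟩
  have := hI.add_colCardL_le i.rev
  simp only [gammaMap]
  omega

theorem injOn_gammaMap (a : ℕ) : Set.InjOn (gammaMap a) {I : Finset (La a) | IsIdeal I} := by
  intro I hI J hJ h
  ext ⟨⟨i, j⟩, hij⟩
  have hi : colCardL I i = colCardL J i := by simpa [gammaMap] using congrFun h i.rev
  rw [IsIdeal.mem_iff_lt hI i j hij, IsIdeal.mem_iff_lt hJ i j hij, hi]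

theorem SZmem.eq_zero_or_add_sub_le {n : ℕ} {x : Fin n → ℕ} (hx : SZmem n x) (i j : Fin n)
    (hij : i ≤ j) : x i = 0 ∨ x i + (j.val - i.val) ≤ x j := by
  obtain ⟨j, hj⟩ := j
  rcases Nat.eq_zero_or_pos (x i) with h | h
  · exact Or.inl h
  right
  replace hij : i.val ≤ j := hij
  induction j, hij using Nat.le_induction with
  | base => simp
  | succ k hk ih =>
    have h₁ := ih (by omega)
    have h₂ := hx.2 ⟨k, by omega⟩ ⟨k + 1, hj⟩ (by simp)
    simp only at h₁ ⊢
    omega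

theorem surjOn_gammaMap (a : ℕ) :
    Set.SurjOn (gammaMap a) {I : Finset (La a) | IsIdeal I} {y : Fin a → ℕ | SZmem a y} := by
  intro y hy
  replace hy : SZmem a y := hy
  refine ⟨Finset.univ.filter (fun p : La a ↦ p.1.2.val < p.1.1.val + y p.1.1.rev), ?_, ?_⟩
  · rintro ⟨⟨i, j⟩, hij⟩ hp ⟨⟨i', j'⟩, hij'⟩ ⟨hi, hj⟩
    simp only [Finset.mem_filter, Finset.mem_univ, true_and] at hp hij hij' hi hj ⊢
    have h := hy.eq_zero_or_add_sub_le i.rev i'.rev (Fin.rev_le_rev.2 hi)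
    simp only [Fin.val_rev, Fin.le_def] at h hi hj
    omega
  · funext k
    refine colCardL_eq_of_mem_iff ?_ ?_
    · have hk := k.isLt
      have h := hy.eq_zero_or_add_sub_le k ⟨a - 1, by omega⟩ (by simp only [Fin.le_def]; omega)
      have h' := hy.1 ⟨a - 1, by omega⟩
      simp only [Fin.val_rev] at h ⊢
      omega
    · rintro p hp
      simp [hp]

/-- The number of elements of column `i` after toggling that column of the ideal `I`. -/
def toggledColCard {a : ℕ} (I : Finset (La a)) (i : Fin a) : ℕ :=
  winchZ a i.rev (gammaMap a I) i.rev

theorem IsIdeal.add_colCardL_le_add_colCardL {a : ℕ} {I : Finset (La a)} (hI : IsIdeal I)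
    {i j : Fin a} (hij : i ≤ j) :
    colCardL I j = 0 ∨ j.val + colCardL I j ≤ i.val + colCardL I i := by
  have h := hI.szmem_gammaMap.eq_zero_or_add_sub_le j.rev i.rev (Fin.rev_le_rev.2 hij)
  simp only [gammaMap, Fin.rev_rev, Fin.val_rev, Fin.le_def] at h hij
  omega

/-- Either the column `i` can grow, and then it grows by one element, or it cannot, and then it
shrinks as far as the columns to its right allow. -/
theorem IsIdeal.toggledColCard_cases {a : ℕ} {I : Finset (La a)} (hI : IsIdeal I) (i : Fin a) :
    (toggledColCard I i = colCardL I i + 1 ∧ i.val + colCardL I i < a ∧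
      ∀ i' < i, i.val + colCardL I i < i'.val + colCardL I i') ∨
    (toggledColCard I i ≤ colCardL I i ∧
      (i.val + colCardL I i < a → ∃ i' < i, i'.val + colCardL I i' ≤ i.val + colCardL I i) ∧
      (∀ i', i < i' →
        colCardL I i' = 0 ∨ i'.val + colCardL I i' ≤ i.val + toggledColCard I i) ∧
      (toggledColCard I i = 0 ∨ ∃ i' : Fin a, i'.val = i.val + 1 ∧ 0 < colCardL I i' ∧
        i'.val + colCardL I i' = i.val + toggledColCard I i)) := by
  have hle := hI.add_colCardL_le i
  have hi := i.isLt
  have hgrow : colCardL I i + 1 < min (extZ a (gammaMap a I) (i.rev.val + 1)) (a + 1) ↔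
      i.val + colCardL I i < a ∧ ∀ i' < i, i.val + colCardL I i < i'.val + colCardL I i' := by
    by_cases h0 : i.val = 0
    · have h : ¬ i.rev.val + 1 < a := by simp only [Fin.val_rev]; omega
      simp only [extZ, h, dite_false, Fin.lt_def]
      grind
    · have h : i.rev.val + 1 < a := by simp only [Fin.val_rev]; omega
      let p : Fin a := ⟨i.val - 1, by omega⟩
      have hp : (⟨i.rev.val + 1, h⟩ : Fin a).rev = p := by
        ext
        simp only [Fin.val_rev, p]
        omega
      have hpi : p.val + 1 = i.val := by simp only [p]; omega
      have hple := hI.add_colCardL_le p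
      simp only [extZ, h, dite_true, gammaMap, hp]
      constructor
      · intro hlt
        refine ⟨by omega, fun i' hi' ↦ ?_⟩
        have := hI.add_colCardL_le_add_colCardL (i := i') (j := p)
          (by simp only [Fin.lt_def, Fin.le_def] at *; omega)
        omega
      · rintro ⟨-, hlt⟩
        have := hlt p (by simp only [Fin.lt_def]; omega)
        omega
  unfold toggledColCard winchZ
  simp only [if_true, show gammaMap a I i.rev = colCardL I i by simp [gammaMap]]
  by_cases hg : colCardL I i + 1 < min (extZ a (gammaMap a I) (i.rev.val + 1)) (a + 1)
  · rw [if_pos hg]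
    exact Or.inl ⟨rfl, hgrow.1 hg⟩
  rw [if_neg hg]
  right
  rw [hgrow] at hg
  push Not at hg
  by_cases hlast : i.val + 1 < a
  · let s : Fin a := ⟨i.val + 1, hlast⟩
    have hs : s.val = i.val + 1 := rfl
    have hrev : ∀ h, (⟨i.rev.val - 1, h⟩ : Fin a).rev = s := by
      intro h
      ext
      simp only [Fin.val_rev, s]
      omega
    have hpos : 0 < i.rev.val := by simp only [Fin.val_rev]; omega
    have hsi := hI.add_colCardL_le_add_colCardL (i := i) (j := s)
      (by simp only [Fin.le_def]; omega)
    have hright : ∀ i', i < i' → colCardL I i' = 0 ∨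
        i'.val + colCardL I i' ≤ s.val + colCardL I s := fun i' hi' ↦
      hI.add_colCardL_le_add_colCardL (by simp only [Fin.lt_def, Fin.le_def] at *; omega)
    simp only [gammaMap, hrev, hpos, true_and]
    split_ifs with hcs
    · refine ⟨by omega, hg, fun i' hi' ↦ ?_, Or.inr ⟨s, hs, hcs, by omega⟩⟩
      have := hright i' hi'
      omega
    · refine ⟨by omega, hg, fun i' hi' ↦ ?_, Or.inl rfl⟩
      have := hI.colCardL_lt hi'
      have := hright i' hi'
      rw [Fin.lt_def] at hi'
      rcases (show s ≤ i' by simp only [Fin.le_def]; omega).eq_or_lt with h | h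
      · rw [← h]; omega
      · have := hI.colCardL_lt h
        omega
  · have hpos : ¬ 0 < i.rev.val := by simp only [Fin.val_rev]; omega
    simp only [hpos, false_and, if_false]
    refine ⟨by omega, hg, fun i' hi' ↦ ?_, Or.inl trivial⟩
    rw [Fin.lt_def] at hi'
    omega

/-- One step of `colToggleL i`. -/
noncomputable def colToggleStep {a : ℕ} (i j : Fin a) (K : Finset (La a)) : Finset (La a) :=
  if h : i.val ≤ j.val then toggle (⟨(i, j), h⟩ : La a) K else K

theorem colToggleL_eq_foldr {a : ℕ} (i : Fin a) (I : Finset (La a)) :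
    colToggleL i I = (List.finRange a).foldr (colToggleStep i) I := by
  rw [colToggleL, show List.ofFn (fun j : Fin a ↦ j) = List.finRange a from List.ofFn_id a]
  rfl

theorem IsIdeal.colToggleStep {a : ℕ} {K : Finset (La a)} (hK : IsIdeal K) (i j : Fin a) :
    IsIdeal (colToggleStep i j K) := by
  unfold _root_.colToggleStep
  split_ifs
  exacts [hK.toggle, hK]

theorem mem_colToggleStep_of_ne {a : ℕ} {i j : Fin a} {K : Finset (La a)} {p : La a}
    (hp : p.1 ≠ (i, j)) : p ∈ colToggleStep i j K ↔ p ∈ K := by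
  unfold colToggleStep
  split_ifs
  · exact mem_toggle_of_ne fun h ↦ hp (by rw [h])
  · rfl

theorem mem_foldr_colToggleStep_of_ne {a : ℕ} {i : Fin a} (l : List (Fin a))
    (I : Finset (La a)) {p : La a} (hp : p.1.1 ≠ i) :
    p ∈ l.foldr (colToggleStep i) I ↔ p ∈ I := by
  induction l with
  | nil => rfl
  | cons j l ih =>
    rw [List.foldr_cons, mem_colToggleStep_of_ne (fun h ↦ hp (by rw [h])), ih]

theorem colCardL_colToggleL_of_ne {a : ℕ} {i k : Fin a} (I : Finset (La a)) (hk : k ≠ i) :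
    colCardL (colToggleL i I) k = colCardL I k := by
  unfold colCardL
  congr 1
  ext p
  simp only [Finset.mem_filter, colToggleL_eq_foldr]
  refine and_congr_left fun hp ↦ mem_foldr_colToggleStep_of_ne _ _ ?_
  rwa [hp]

theorem IsIdeal.foldr_colToggleStep {a : ℕ} {I : Finset (La a)} (hI : IsIdeal I) (i : Fin a)
    (l : List (Fin a)) : IsIdeal (l.foldr (_root_.colToggleStep i) I) := by
  induction l with
  | nil => exact hI
  | cons j l ih => exact ih.colToggleStep i j

/-- The effect of toggling `(i, k)` when the elements of column `i` above it have already been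
toggled. -/
theorem IsIdeal.mem_toggle_col_iff {a : ℕ} {I K : Finset (La a)} (hI : IsIdeal I)
    (hK : IsIdeal K) {i k : Fin a} (hik : i.val ≤ k.val)
    (hne : ∀ p : La a, p.1.1 ≠ i → (p ∈ K ↔ p ∈ I))
    (hcol : ∀ (j : Fin a) (hij : i.val ≤ j.val), (⟨(i, j), hij⟩ : La a) ∈ K ↔
      j.val < i.val + if k.val < j.val then toggledColCard I i else colCardL I i) :
    (⟨(i, k), hik⟩ : La a) ∈ _root_.toggle (⟨(i, k), hik⟩ : La a) K ↔
      k.val < i.val + toggledColCard I i := by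
  have hk := k.isLt
  have hkK : (⟨(i, k), hik⟩ : La a) ∈ K ↔ k.val < i.val + colCardL I i := by simp [hcol]
  have hne' : ∀ (i' j : Fin a) (hij : i'.val ≤ j.val), i' ≠ i →
      ((⟨(i', j), hij⟩ : La a) ∈ K ↔ j.val < i'.val + colCardL I i') := fun i' j hij h ↦
    (hne _ h).trans (hI.mem_iff_lt i' j hij)
  have hbelow : (∀ z < (⟨(i, k), hik⟩ : La a), z ∈ K) → k.val ≤ i.val + colCardL I i := by
    intro h
    by_contra! hlt
    have := (hcol ⟨k.val - 1, by omega⟩ (by simp only; omega)).1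
      (h _ (by simp only [← Subtype.coe_lt_coe, Prod.lt_iff, Fin.lt_def, Fin.le_def]; omega))
    simp only at this
    rw [if_neg (by omega)] at this
    omega
  have habove : (∃ z, (⟨(i, k), hik⟩ : La a) < z ∧ z ∈ K) →
      k.val + 1 < i.val + toggledColCard I i ∨
        ∃ i', i < i' ∧ 0 < colCardL I i' ∧ k.val < i'.val + colCardL I i' := by
    rintro ⟨⟨⟨i', j⟩, hij⟩, hlt, hz⟩
    simp only [← Subtype.coe_lt_coe, Prod.lt_iff, Fin.lt_def, Fin.le_def] at hlt hij
    by_cases h : i' = i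
    · subst h
      have hz := (hcol j hij).1 hz
      rw [if_pos (by omega)] at hz
      omega
    · have hz := (hne' i' j hij h).1 hz
      rw [Fin.ext_iff] at h
      exact Or.inr ⟨i', by rw [Fin.lt_def]; omega, by omega, by omega⟩
  rw [mem_toggle_self hK, hkK]
  rcases hI.toggledColCard_cases i with ⟨ht, hc, hleft⟩ | ⟨ht, hleft, hright, hcover⟩
  · rw [ht] at hcol habove ⊢
    constructor
    · rintro (h | ⟨-, h⟩)
      · rcases habove h with h | ⟨i', hi', hpos, h⟩
        · omega
        · have := hI.add_colCardL_le_add_colCardL hi'.le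
          omega
      · have := hbelow h
        omega
    · intro h
      by_cases hkc : k.val < i.val + colCardL I i
      · left
        refine ⟨⟨(i, ⟨k.val + 1, by omega⟩), by simp only; omega⟩, ?_, ?_⟩
        · simp only [← Subtype.coe_lt_coe, Prod.lt_iff, Fin.lt_def, Fin.le_def]
          omega
        · rw [hcol]
          simp only
          rw [if_pos (by omega)]
          omega
      · right
        refine ⟨hkc, ?_⟩
        rintro ⟨⟨i', j⟩, hij⟩ hz
        simp only [← Subtype.coe_lt_coe, Prod.lt_iff, Fin.lt_def, Fin.le_def] at hz hij
        by_cases hi' : i' = i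
        · subst hi'
          rw [hcol, if_neg (by omega)]
          omega
        · rw [hne' i' j hij hi']
          rw [Fin.ext_iff] at hi'
          have := hleft i' (by rw [Fin.lt_def]; omega)
          omega
  · constructor
    · rintro (h | ⟨hkc, h⟩)
      · rcases habove h with h | ⟨i', hi', hpos, h⟩
        · omega
        · have := hright i' hi'
          omega
      · have hkeq := hbelow h
        obtain ⟨i', hi', hle⟩ := hleft (by omega)
        have hz := h ⟨(i', k), by rw [Fin.lt_def] at hi'; simp only; omega⟩ (by
          simp only [← Subtype.coe_lt_coe, Prod.lt_iff, Fin.lt_def, Fin.le_def] at hi' ⊢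
          omega)
        rw [hne' _ _ _ hi'.ne] at hz
        omega
    · intro h
      rcases hcover with hcover | ⟨i', hi', hpos, hcover⟩
      · omega
      · left
        have hi'a := hI.add_colCardL_le i'
        refine ⟨⟨(i', ⟨max k.val i'.val, by omega⟩), by simp only; omega⟩, ?_, ?_⟩
        · simp only [← Subtype.coe_lt_coe, Prod.lt_iff, Fin.lt_def, Fin.le_def]
          omega
        · rw [hne' _ _ _ (by rw [Ne, Fin.ext_iff]; omega)]
          simp only
          omega

theorem IsIdeal.mem_foldr_drop_iff {a : ℕ} {I : Finset (La a)} (hI : IsIdeal I) (i : Fin a)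
    {k : ℕ} (hk : k ≤ a) (j : Fin a) (hij : i.val ≤ j.val) :
    (⟨(i, j), hij⟩ : La a) ∈ ((List.finRange a).drop k).foldr (_root_.colToggleStep i) I ↔
      j.val < i.val + if k ≤ j.val then toggledColCard I i else colCardL I i := by
  induction hk using Nat.decreasingInduction generalizing j with
  | self =>
    rw [List.drop_of_length_le (by simp), List.foldr_nil, if_neg (by omega)]
    exact hI.mem_iff_lt i j hij
  | of_succ k hk ih =>
    rw [List.drop_eq_getElem_cons (by simpa using hk), List.foldr_cons]
    simp only [List.getElem_finRange, Fin.cast_mk]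
    by_cases hjk : j.val = k
    · obtain rfl : j = ⟨k, hk⟩ := Fin.ext hjk
      rw [_root_.colToggleStep, dif_pos hij]
      simpa using hI.mem_toggle_col_iff (hI.foldr_colToggleStep i _) hij
        (fun p hp ↦ mem_foldr_colToggleStep_of_ne _ _ hp) ih
    · rw [mem_colToggleStep_of_ne (by simpa [Fin.ext_iff] using hjk), ih]
      simp only [show k + 1 ≤ j.val ↔ k ≤ j.val by omega]

theorem IsIdeal.colCardL_colToggleL_self {a : ℕ} {I : Finset (La a)} (hI : IsIdeal I)
    (i : Fin a) : colCardL (colToggleL i I) i = toggledColCard I i := by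
  refine colCardL_eq_of_mem_iff ?_ ?_
  · have := hI.add_colCardL_le i
    rcases hI.toggledColCard_cases i with h | h <;> omega
  · rintro ⟨⟨i', j⟩, hij⟩ rfl
    simpa [colToggleL_eq_foldr] using hI.mem_foldr_drop_iff i' (Nat.zero_le a) j hij

/-- `γ` is a bijection from the order ideals of `L_a` onto `S_a`, and it
intertwines the column toggle `σ_{C_j}` with winching with zeros `WZ_{a+1−j}` (in 0-based
indexing, column `j` corresponds to index `j.rev`). -/
theorem stmt_4 (a : ℕ) (ha : 1 ≤ a) :
    Set.BijOn (gammaMap a) {I : Finset (La a) | IsIdeal I} {y : Fin a → ℕ | SZmem a y} ∧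
    ∀ I : Finset (La a), IsIdeal I → ∀ j : Fin a,
      gammaMap a (colToggleL j I) = winchZ a j.rev (gammaMap a I) := by
  refine ⟨⟨fun I hI ↦ IsIdeal.szmem_gammaMap hI, injOn_gammaMap a, surjOn_gammaMap a⟩,
    fun I hI i ↦ ?_⟩
  funext k
  by_cases hk : k = i.rev
  · subst hk
    simpa [gammaMap, toggledColCard] using hI.colCardL_colToggleL_self i
  · rw [winchZ, if_neg hk]
    exact colCardL_colToggleL_of_ne I (fun h ↦ hk (by rw [← h, Fin.rev_rev]))
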